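/- Let k ≥ 1 and let A ⊆ ℤ^k be an infinite set with discrete mass dimension δ (with respect to the Euclidean norm). Then the Gaussian-weighted sum S(T) = ∑_{α ∈ A} e^{-‖α‖²/(2T)} (which converges for every T > 0) satisfies lim_{T → ∞} (log S(T))/(log T) = δ/2. -/

import Mathlib

open Filter Real

/-- The Euclidean norm of a lattice point `α ∈ ℤ^k`. -/
noncomputable def latNorm {k : ℕ} (α : Fin k → ℤ) : ℝ :=
  Real.sqrt (∑ i, ((α i : ℝ)) ^ 2)

/-- `N_A(r) = #{α ∈ A : ‖α‖ ≤ r}` for the Euclidean norm. -/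
noncomputable def latCount {k : ℕ} (A : Set (Fin k → ℤ)) (r : ℝ) : ℕ :=
  Nat.card {α : Fin k → ℤ // α ∈ A ∧ latNorm α ≤ r}

lemma finite_lat {k : ℕ} (A : Set (Fin k → ℤ)) (r : ℝ) :
    {α : A | latNorm (α : Fin k → ℤ) ≤ r}.Finite := by
  have h : {α : Fin k → ℤ | latNorm α ≤ r}.Finite := by
    apply (Set.finite_Icc (fun _ : Fin k => -⌈r⌉) (fun _ : Fin k => ⌈r⌉)).subset
    intro α hα
    have hα' : latNorm α ≤ r := hα
    have key : ∀ i, |(α i : ℝ)| ≤ r := by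
      intro i
      refine le_trans ?_ hα'
      apply Real.abs_le_sqrt
      exact Finset.single_le_sum (f := fun i => (α i : ℝ) ^ 2) (fun j _ => sq_nonneg _)
        (Finset.mem_univ i)
    refine ⟨fun i => ?_, fun i => ?_⟩
    · have h1 := (abs_le.1 (key i)).1
      have h2 : -(⌈r⌉ : ℝ) ≤ α i := by linarith [Int.le_ceil r]
      exact_mod_cast h2
    · have h1 := (abs_le.1 (key i)).2
      have h2 : (α i : ℝ) ≤ ⌈r⌉ := by linarith [Int.le_ceil r]
      exact_mod_cast h2
  exact Set.Finite.preimage Subtype.val_injective.injOn h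

lemma latCount_eq {k : ℕ} (A : Set (Fin k → ℤ)) (r : ℝ) :
    latCount A r = (finite_lat A r).toFinset.card := by
  rw [← Set.ncard_eq_toFinset_card _ (finite_lat A r), ← Nat.card_coe_set_eq]
  exact Nat.card_congr (Equiv.subtypeSubtypeEquivSubtypeInter (fun α => α ∈ A)
    (fun α => latNorm α ≤ r)).symm

lemma latCount_mono {k : ℕ} (A : Set (Fin k → ℤ)) : Monotone (latCount A) := by
  intro r s h
  rw [latCount_eq, latCount_eq]
  apply Finset.card_le_card
  intro α
  simp only [Set.Finite.mem_toFinset, Set.mem_ofPred_eq]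
  exact fun h' => h'.trans h

lemma latNorm_nonneg {k : ℕ} (α : Fin k → ℤ) : 0 ≤ latNorm α := Real.sqrt_nonneg _

lemma exp_le_tsum (x : ℝ) (hx : 0 ≤ x) :
    ENNReal.ofReal (Real.exp (-x)) ≤
      ∑' n : ℕ, if x ≤ n + 1 then ENNReal.ofReal (Real.exp (-n)) else 0 := by
  refine le_trans ?_ (ENNReal.le_tsum ⌊x⌋₊)
  rw [if_pos (Nat.lt_floor_add_one x).le]
  apply ENNReal.ofReal_le_ofReal
  apply Real.exp_le_exp.2
  linarith [Nat.floor_le hx]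

lemma tsum_ind {k : ℕ} (A : Set (Fin k → ℤ)) (r : ℝ) (c : ENNReal) :
    (∑' α : A, if latNorm (α : Fin k → ℤ) ≤ r then c else 0) = latCount A r * c := by
  rw [latCount_eq, tsum_eq_sum (s := (finite_lat A r).toFinset)]
  · rw [Finset.sum_congr rfl (g := fun _ => c)]
    · simp
    · intro α hα
      rw [if_pos (by simpa using hα)]
  · intro α hα
    rw [if_neg (by simpa using hα)]

lemma summable_aux (q : ℝ) :
    Summable (fun n : ℕ => ((n : ℝ) + 1) ^ q * Real.exp (-n)) := by
  have h := Real.summable_pow_mul_exp_neg_nat_mul ⌈q⌉₊ (r := 1) one_pos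
  have h2 := ((summable_nat_add_iff 1).2 h).mul_right (Real.exp 1)
  refine Summable.of_nonneg_of_le (fun n => by positivity) (fun n => ?_) h2
  push_cast
  rw [mul_assoc, ← Real.exp_add]
  have : (-1 * ((n : ℝ) + 1) + 1) = -n := by ring
  rw [this]
  gcongr
  rw [← Real.rpow_natCast]
  apply Real.rpow_le_rpow_of_exponent_le
  · linarith [(Nat.cast_nonneg n : (0 : ℝ) ≤ n)]
  · exact Nat.le_ceil q

lemma upper {k : ℕ} (A : Set (Fin k → ℤ)) (C q : ℝ) (hC : 0 ≤ C) (hq : 0 ≤ q)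
    (hN : ∀ r : ℝ, 0 ≤ r → (latCount A r : ℝ) ≤ C * (1 + r ^ 2) ^ q) (T : ℝ) (hT : 0 < T) :
    Summable (fun α : A => Real.exp (-(latNorm (α : Fin k → ℤ)) ^ 2 / (2 * T))) ∧
    (∑' α : A, Real.exp (-(latNorm (α : Fin k → ℤ)) ^ 2 / (2 * T))) ≤
      C * (2 * (1 + T)) ^ q * ∑' n : ℕ, ((n : ℝ) + 1) ^ q * Real.exp (-n) := by
  set B := C * (2 * (1 + T)) ^ q * ∑' n : ℕ, ((n : ℝ) + 1) ^ q * Real.exp (-n) with hB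
  have hB0 : 0 ≤ B := by
    have : 0 ≤ ∑' n : ℕ, ((n : ℝ) + 1) ^ q * Real.exp (-n) :=
      tsum_nonneg (fun n => by positivity)
    positivity
  have key : (∑' α : A, ENNReal.ofReal (Real.exp (-(latNorm (α : Fin k → ℤ)) ^ 2 / (2 * T))))
      ≤ ENNReal.ofReal B := by
    calc _ ≤ ∑' α : A, ∑' n : ℕ, (if latNorm (α : Fin k → ℤ) ≤ √(2 * T * (n + 1)) then
              ENNReal.ofReal (Real.exp (-n)) else 0) := by
            refine ENNReal.tsum_le_tsum (fun α => ?_)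
            have h := exp_le_tsum ((latNorm (α : Fin k → ℤ)) ^ 2 / (2 * T)) (by positivity)
            rw [neg_div]
            refine h.trans (ENNReal.tsum_le_tsum (fun n => ?_))
            have : (latNorm (α : Fin k → ℤ)) ^ 2 / (2 * T) ≤ n + 1 ↔
                latNorm (α : Fin k → ℤ) ≤ √(2 * T * (n + 1)) := by
              rw [Real.le_sqrt (latNorm_nonneg _), div_le_iff₀ (by positivity), mul_comm]
              positivity
            simp only [this, le_refl]
      _ = ∑' n : ℕ, (latCount A √(2 * T * (n + 1)) : ENNReal) *
            ENNReal.ofReal (Real.exp (-n)) := by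
            rw [ENNReal.tsum_comm]
            simp only [tsum_ind]
      _ ≤ ∑' n : ℕ, ENNReal.ofReal (C * (2 * (1 + T)) ^ q *
            (((n : ℝ) + 1) ^ q * Real.exp (-n))) := by
            refine ENNReal.tsum_le_tsum (fun n => ?_)
            rw [← ENNReal.ofReal_natCast, ← ENNReal.ofReal_mul (by positivity)]
            apply ENNReal.ofReal_le_ofReal
            rw [← mul_assoc]
            gcongr
            refine (hN _ (Real.sqrt_nonneg _)).trans ?_
            rw [Real.sq_sqrt (by positivity), mul_assoc C, ← Real.mul_rpow (by positivity)
              (by positivity)]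
            gcongr
            nlinarith [(Nat.cast_nonneg n : (0 : ℝ) ≤ n)]
      _ = ENNReal.ofReal B := by
            rw [← ENNReal.ofReal_tsum_of_nonneg (fun n => by positivity)
              ((summable_aux q).mul_left _), tsum_mul_left]
  have hs : Summable (fun α : A => Real.exp (-(latNorm (α : Fin k → ℤ)) ^ 2 / (2 * T))) := by
    have h := ENNReal.summable_toReal (ne_top_of_le_ne_top ENNReal.ofReal_ne_top key)
    refine h.congr (fun α => ?_)
    rw [ENNReal.toReal_ofReal (Real.exp_pos _).le]
  refine ⟨hs, ?_⟩
  rw [← ENNReal.ofReal_tsum_of_nonneg (fun α => (Real.exp_pos _).le) hs] at key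
  exact (ENNReal.ofReal_le_ofReal_iff hB0).1 key

lemma lower {k : ℕ} (A : Set (Fin k → ℤ)) (T : ℝ) (hT : 0 < T)
    (hs : Summable (fun α : A => Real.exp (-(latNorm (α : Fin k → ℤ)) ^ 2 / (2 * T)))) :
    latCount A √T * Real.exp (-(1 / 2)) ≤
      ∑' α : A, Real.exp (-(latNorm (α : Fin k → ℤ)) ^ 2 / (2 * T)) := by
  refine le_trans ?_ (hs.sum_le_tsum (finite_lat A √T).toFinset (fun α _ => (Real.exp_pos _).le))
  rw [latCount_eq, ← nsmul_eq_mul]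
  apply Finset.card_nsmul_le_sum
  intro α hα
  have h : latNorm (α : Fin k → ℤ) ≤ √T := by simpa using hα
  have h0 := latNorm_nonneg (α : Fin k → ℤ)
  have h : latNorm (α : Fin k → ℤ) ^ 2 ≤ T := by nlinarith [Real.sq_sqrt hT.le, Real.sqrt_nonneg T]
  apply Real.exp_le_exp.2
  rw [neg_div, neg_le_neg_iff, div_le_iff₀ (by positivity)]
  linarith

lemma count_bound {k : ℕ} (A : Set (Fin k → ℤ)) (δ q : ℝ)
    (hdim : Tendsto (fun r : ℝ => Real.log (latCount A r) / Real.log r) atTop (nhds δ))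
    (hq : 0 ≤ q) (hδ : δ < 2 * q) :
    ∃ C : ℝ, 0 < C ∧ ∀ r : ℝ, 0 ≤ r → (latCount A r : ℝ) ≤ C * (1 + r ^ 2) ^ q := by
  have h := (hdim.eventually_lt_const hδ).and (eventually_gt_atTop 1)
  obtain ⟨R, hR⟩ := eventually_atTop.1 h
  refine ⟨latCount A R + 1, by positivity, fun r hr => ?_⟩
  have h1 : 1 ≤ (1 + r ^ 2) ^ q := Real.one_le_rpow (by nlinarith [sq_nonneg r]) hq
  rcases le_total r R with hrR | hrR
  · have : (latCount A r : ℝ) ≤ latCount A R := by exact_mod_cast latCount_mono A hrR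
    have h0 : (0 : ℝ) ≤ latCount A R := Nat.cast_nonneg _
    nlinarith
  · obtain ⟨h2, h3⟩ := hR r hrR
    rw [div_lt_iff₀ (Real.log_pos h3)] at h2
    have h0 : (0 : ℝ) ≤ latCount A R := Nat.cast_nonneg _
    have h4 : (latCount A r : ℝ) ≤ (1 + r ^ 2) ^ q := by
      rcases Nat.eq_zero_or_pos (latCount A r) with hz | hz
      · rw [hz]; push_cast; linarith
      · have hz' : (0 : ℝ) < latCount A r := by exact_mod_cast hz
        calc (latCount A r : ℝ) = Real.exp (Real.log (latCount A r)) := (Real.exp_log hz').symm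
          _ ≤ Real.exp (Real.log (r ^ 2) * q) := by
              apply Real.exp_le_exp.2
              rw [Real.log_pow]; push_cast; linarith
          _ = (r ^ 2) ^ q := by rw [Real.rpow_def_of_pos (by positivity)]
          _ ≤ (1 + r ^ 2) ^ q := by gcongr; linarith
    nlinarith

/-- If `A ⊆ ℤ^k` is infinite with discrete mass dimension `δ`, then the Gaussian-weighted
sum `S(T) = ∑_{α ∈ A} e^{-‖α‖²/(2T)}` converges for every `T > 0` and satisfies
`lim_{T → ∞} log S(T) / log T = δ/2`. -/
theorem gaussian_sum_log_dimension (k : ℕ) (hk : 1 ≤ k) (A : Set (Fin k → ℤ))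
    (hA : A.Infinite) (δ : ℝ)
    (hdim : Tendsto (fun r : ℝ => Real.log (latCount A r) / Real.log r) atTop (nhds δ)) :
    (∀ T : ℝ, 0 < T →
      Summable (fun α : A => Real.exp (-(latNorm (α : Fin k → ℤ)) ^ 2 / (2 * T)))) ∧
    Tendsto
      (fun T : ℝ =>
        Real.log (∑' α : A, Real.exp (-(latNorm (α : Fin k → ℤ)) ^ 2 / (2 * T))) / Real.log T)
      atTop (nhds (δ / 2)) := by
  have hδ : 0 ≤ δ := by
    refine ge_of_tendsto hdim ?_
    filter_upwards [eventually_ge_atTop 1] with r hr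
    exact div_nonneg (Real.log_natCast_nonneg _) (Real.log_nonneg hr)
  have hsum : ∀ T : ℝ, 0 < T →
      Summable (fun α : A => Real.exp (-(latNorm (α : Fin k → ℤ)) ^ 2 / (2 * T))) := by
    obtain ⟨C, hC, hN⟩ := count_bound A δ (δ + 1) hdim (by linarith) (by linarith)
    exact fun T hT => (upper A C (δ + 1) hC.le (by linarith) hN T hT).1
  refine ⟨hsum, ?_⟩
  obtain ⟨a, ha⟩ := hA.nonempty
  have hpos : ∀ r, latNorm a ≤ r → 0 < latCount A r := by
    intro r hr
    rw [latCount_eq]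
    exact Finset.card_pos.2 ⟨⟨a, ha⟩, by simpa using hr⟩
  have hSpos : ∀ T : ℝ, 0 < T →
      0 < ∑' α : A, Real.exp (-(latNorm (α : Fin k → ℤ)) ^ 2 / (2 * T)) :=
    fun T hT => (hsum T hT).tsum_pos (fun α => (Real.exp_pos _).le) ⟨a, ha⟩ (Real.exp_pos _)
  have hsq : Tendsto (fun T : ℝ => √T) atTop atTop := Real.tendsto_sqrt_atTop
  have hinv : ∀ c : ℝ, Tendsto (fun T : ℝ => c / Real.log T) atTop (nhds 0) :=
    fun c => tendsto_const_nhds.div_atTop Real.tendsto_log_atTop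
  rw [tendsto_order]
  constructor
  · intro b hb
    have h1 : Tendsto (fun T : ℝ => Real.log (latCount A √T) / Real.log √T * (1 / 2) -
        (1 / 2) / Real.log T) atTop (nhds (δ * (1 / 2) - 0)) :=
      ((hdim.comp hsq).mul_const _).sub (hinv _)
    filter_upwards [h1.eventually_const_lt (by linarith : b < δ * (1 / 2) - 0),
      eventually_gt_atTop 1, hsq.eventually_ge_atTop (latNorm a)] with T hT hT1 hTa
    refine hT.trans_le ?_
    have hl : 0 < Real.log T := Real.log_pos hT1
    have hc : (0 : ℝ) < latCount A √T := by exact_mod_cast hpos _ hTa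
    have h2 := Real.log_le_log (by positivity) (lower A T (by linarith) (hsum T (by linarith)))
    rw [Real.log_mul hc.ne' (Real.exp_pos _).ne', Real.log_exp] at h2
    rw [Real.log_sqrt (by linarith)]
    have h3 : Real.log (latCount A √T) / (Real.log T / 2) * (1 / 2) - (1 / 2) / Real.log T =
      (Real.log (latCount A √T) + -(1 / 2)) / Real.log T := by
      field_simp
      ring
    rw [h3]
    gcongr
  · intro b hb
    obtain ⟨q, hq1, hq2⟩ := exists_between hb
    have hq0 : 0 ≤ q := by linarith
    obtain ⟨C, hC, hN⟩ := count_bound A δ q hdim hq0 (by linarith)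
    set K := ∑' n : ℕ, ((n : ℝ) + 1) ^ q * Real.exp (-n) with hK
    have hKpos : 0 < K := (summable_aux q).tsum_pos (fun n => by positivity) 0 (by positivity)
    have h1 : Tendsto (fun T : ℝ => Real.log (C * 4 ^ q * K) / Real.log T + q) atTop
        (nhds (0 + q)) := (hinv _).add_const _
    filter_upwards [h1.eventually_lt_const (by linarith : 0 + q < b),
      eventually_gt_atTop 1] with T hT hT1
    refine lt_of_le_of_lt ?_ hT
    have hl : 0 < Real.log T := Real.log_pos hT1
    have hT0 : 0 < T := by linarith
    have h2 := (upper A C q hC.le hq0 hN T hT0).2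
    have h3 : C * (2 * (1 + T)) ^ q * K ≤ C * 4 ^ q * K * T ^ q := by
      have : (2 * (1 + T)) ^ q ≤ 4 ^ q * T ^ q := by
        rw [← Real.mul_rpow (by norm_num) hT0.le]
        exact Real.rpow_le_rpow (by positivity) (by linarith) hq0
      calc C * (2 * (1 + T)) ^ q * K ≤ C * (4 ^ q * T ^ q) * K := by gcongr
        _ = _ := by ring
    have h4 := Real.log_le_log (hSpos T hT0) (h2.trans h3)
    rw [Real.log_mul (by positivity) (by positivity), Real.log_rpow hT0] at h4
    rw [div_le_iff₀ hl, add_mul, div_mul_cancel₀ _ hl.ne']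
    exact h4
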